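/- Semialgebraic description of the open spurion tile: let Z ∈ Mat^{>0}_{9,6} with rows Z_1,…,Z_9. For a 2×6 real matrix Y of rank 2 and an ordered tuple (i_1,i_2,i_3,i_4), write ⟪i_1 i_2 i_3 i_4⟫_Y for the determinant of the 6×6 matrix whose first two rows are the rows of Y and whose last four rows are Z_{i_1}, Z_{i_2}, Z_{i_3}, Z_{i_4}; define a_1(Y) = ⟪1236⟫⟪5789⟫ − ⟪1235⟫⟪6789⟫, a_2(Y) = ⟪1236⟫⟪4789⟫ − ⟪1234⟫⟪6789⟫, a_3(Y) = ⟪1235⟫⟪4789⟫ − ⟪1234⟫⟪5789⟫, a_4(Y) = ⟪7892⟫⟪3456⟫ − ⟪7893⟫⟪2456⟫, a_5(Y) = ⟪7891⟫⟪3456⟫ − ⟪7893⟫⟪1456⟫, a_6(Y) = ⟪7891⟫⟪2456⟫ − ⟪7892⟫⟪1456⟫, a_7(Y) = ⟪4568⟫⟪9123⟫ − ⟪4569⟫⟪8123⟫, a_8(Y) = ⟪4567⟫⟪9123⟫ − ⟪4569⟫⟪7123⟫, a_9(Y) = ⟪4567⟫⟪8123⟫ − ⟪4568⟫⟪7123⟫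 (each is homogeneous of degree 2 in the rows of Y, so its sign depends only on the row span of Y). Then a 2-dimensional subspace V of ℝ^6 is of the form V = rowspan(CZ) for some C in the spurion cell S_sp if and only if, for one (equivalently, every) rank-2 matrix Y with row span V, one has a_2(Y) > 0, a_5(Y) > 0, a_8(Y) > 0 and a_1(Y), a_3(Y), a_4(Y), a_6(Y), a_7(Y), a_9(Y) all strictly negative. -/

import Mathlib

open Finset

/-- The `2 × 2` minor `⟨{i,j}⟩_C` of a `2 × 9` matrix on columns `i` and `j`. -/
noncomputable def minor2 (C : Matrix (Fin 2) (Fin 9) ℝ) (i j : Fin 9) : ℝ :=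
  C 0 i * C 1 j - C 0 j * C 1 i

/-- The spurion cell `S_sp ⊆ Mat_{2,9}(ℝ)`: the `2 × 2` minor on columns `i < j`
vanishes when `i` and `j` lie in the same block of `{1,2,3}, {4,5,6}, {7,8,9}`
(`0`-based: blocks of `⌊·/3⌋`), and is strictly positive when they lie in
different blocks. -/
def SpurionCell (C : Matrix (Fin 2) (Fin 9) ℝ) : Prop :=
  ∀ i j : Fin 9, i < j →
    (((i : ℕ) / 3 = (j : ℕ) / 3 → minor2 C i j = 0) ∧
     ((i : ℕ) / 3 ≠ (j : ℕ) / 3 → 0 < minor2 C i j))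

/-- The `6 × 6` minor of a `9 × 6` matrix `Z` on the rows indexed by `S`,
taken in increasing order (junk value `0` if `S.card ≠ 6`). -/
noncomputable def rowMinor (Z : Matrix (Fin 9) (Fin 6) ℝ) (S : Finset (Fin 9)) : ℝ :=
  if h : S.card = 6 then (Z.submatrix ⇑(S.orderEmbOfFin h) id).det else 0

/-- `Mat^{>0}_{9,6}`: all `6 × 6` minors are positive. -/
def PosMat (Z : Matrix (Fin 9) (Fin 6) ℝ) : Prop :=
  ∀ S : Finset (Fin 9), S.card = 6 → 0 < rowMinor Z S

/-- The span of the rows of a matrix. -/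
def rowSpan {m n : ℕ} (M : Matrix (Fin m) (Fin n) ℝ) : Submodule ℝ (Fin n → ℝ) :=
  Submodule.span ℝ (Set.range fun i => M i)

/-- The twistor coordinate `⟪i₁ i₂ i₃ i₄⟫_Y` of the ordered tuple `(i₁, i₂, i₃, i₄)`:
the determinant of the `6 × 6` matrix whose first two rows are the rows of `Y` and
whose last four rows are `Z_{i₁}, Z_{i₂}, Z_{i₃}, Z_{i₄}` in that order. -/
noncomputable def twY (Z : Matrix (Fin 9) (Fin 6) ℝ) (Y : Matrix (Fin 2) (Fin 6) ℝ)
    (i₁ i₂ i₃ i₄ : Fin 9) : ℝ :=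
  (Matrix.of ![Y 0, Y 1, Z i₁, Z i₂, Z i₃, Z i₄]).det

/-- The sign conditions cutting out the open spurion tile: writing `1, …, 9` for the
`0`-based indices `0, …, 8`, the functionaries `a₂(Y), a₅(Y), a₈(Y)` are strictly
positive and `a₁(Y), a₃(Y), a₄(Y), a₆(Y), a₇(Y), a₉(Y)` are strictly negative. -/
def SpurionSigns (Z : Matrix (Fin 9) (Fin 6) ℝ) (Y : Matrix (Fin 2) (Fin 6) ℝ) : Prop :=
  -- a₂ = ⟪1236⟫⟪4789⟫ − ⟪1234⟫⟪6789⟫ > 0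
  (0 < twY Z Y 0 1 2 5 * twY Z Y 3 6 7 8 - twY Z Y 0 1 2 3 * twY Z Y 5 6 7 8) ∧
  -- a₅ = ⟪7891⟫⟪3456⟫ − ⟪7893⟫⟪1456⟫ > 0
  (0 < twY Z Y 6 7 8 0 * twY Z Y 2 3 4 5 - twY Z Y 6 7 8 2 * twY Z Y 0 3 4 5) ∧
  -- a₈ = ⟪4567⟫⟪9123⟫ − ⟪4569⟫⟪7123⟫ > 0
  (0 < twY Z Y 3 4 5 6 * twY Z Y 8 0 1 2 - twY Z Y 3 4 5 8 * twY Z Y 6 0 1 2) ∧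
  -- a₁ = ⟪1236⟫⟪5789⟫ − ⟪1235⟫⟪6789⟫ < 0
  (twY Z Y 0 1 2 5 * twY Z Y 4 6 7 8 - twY Z Y 0 1 2 4 * twY Z Y 5 6 7 8 < 0) ∧
  -- a₃ = ⟪1235⟫⟪4789⟫ − ⟪1234⟫⟪5789⟫ < 0
  (twY Z Y 0 1 2 4 * twY Z Y 3 6 7 8 - twY Z Y 0 1 2 3 * twY Z Y 4 6 7 8 < 0) ∧
  -- a₄ = ⟪7892⟫⟪3456⟫ − ⟪7893⟫⟪2456⟫ < 0
  (twY Z Y 6 7 8 1 * twY Z Y 2 3 4 5 - twY Z Y 6 7 8 2 * twY Z Y 1 3 4 5 < 0) ∧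
  -- a₆ = ⟪7891⟫⟪2456⟫ − ⟪7892⟫⟪1456⟫ < 0
  (twY Z Y 6 7 8 0 * twY Z Y 1 3 4 5 - twY Z Y 6 7 8 1 * twY Z Y 0 3 4 5 < 0) ∧
  -- a₇ = ⟪4568⟫⟪9123⟫ − ⟪4569⟫⟪8123⟫ < 0
  (twY Z Y 3 4 5 7 * twY Z Y 8 0 1 2 - twY Z Y 3 4 5 8 * twY Z Y 7 0 1 2 < 0) ∧
  -- a₉ = ⟪4567⟫⟪8123⟫ − ⟪4568⟫⟪7123⟫ < 0
  (twY Z Y 3 4 5 6 * twY Z Y 7 0 1 2 - twY Z Y 3 4 5 7 * twY Z Y 6 0 1 2 < 0)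

/-- The determinant of the `6 × 6` matrix with the given rows. -/
noncomputable def det6 (a b c d e f : Fin 6 → ℝ) : ℝ :=
  (Matrix.of ![a, b, c, d, e, f]).det

section det6

variable (a a' b b' c c' d e f : Fin 6 → ℝ) (r : ℝ)

lemma det6_comp_swap {i j : Fin 6} (hij : i ≠ j) {v w : Fin 6 → Fin 6 → ℝ}
    (h : ∀ k, w k = v (Equiv.swap i j k)) : (Matrix.of w).det = -(Matrix.of v).det := by
  have hw : Matrix.of w = (Matrix.of v).submatrix (Equiv.swap i j) id := by
    ext k l
    exact congrFun (h k) l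
  rw [hw, Matrix.det_permute, Equiv.Perm.sign_swap hij]
  simp

lemma det6_swap01 : det6 a b c d e f = -det6 b a c d e f :=
  det6_comp_swap (i := 0) (j := 1) (by decide) fun k => by
    fin_cases k <;> simp [Equiv.swap_apply_def]

lemma det6_swap12 : det6 a b c d e f = -det6 a c b d e f :=
  det6_comp_swap (i := 1) (j := 2) (by decide) fun k => by
    fin_cases k <;> simp [Equiv.swap_apply_def]

lemma det6_swap23 : det6 a b c d e f = -det6 a b d c e f :=
  det6_comp_swap (i := 2) (j := 3) (by decide) fun k => by
    fin_cases k <;> simp [Equiv.swap_apply_def]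

lemma det6_swap34 : det6 a b c d e f = -det6 a b c e d f :=
  det6_comp_swap (i := 3) (j := 4) (by decide) fun k => by
    fin_cases k <;> simp [Equiv.swap_apply_def]

lemma det6_swap45 : det6 a b c d e f = -det6 a b c d f e :=
  det6_comp_swap (i := 4) (j := 5) (by decide) fun k => by
    fin_cases k <;> simp [Equiv.swap_apply_def]

lemma det6_add0 : det6 (a + a') b c d e f = det6 a b c d e f + det6 a' b c d e f := by
  have key : ∀ x, (Matrix.of ![a, b, c, d, e, f]).updateRow 0 x =
      Matrix.of ![x, b, c, d, e, f] := by
    intro x; ext i j; fin_cases i <;> rfl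
  simpa only [key, det6] using Matrix.det_updateRow_add (Matrix.of ![a, b, c, d, e, f]) 0 a a'

lemma det6_smul0 : det6 (r • a) b c d e f = r * det6 a b c d e f := by
  have key : ∀ x, (Matrix.of ![a, b, c, d, e, f]).updateRow 0 x =
      Matrix.of ![x, b, c, d, e, f] := by
    intro x; ext i j; fin_cases i <;> rfl
  simpa only [key, det6] using Matrix.det_updateRow_smul (Matrix.of ![a, b, c, d, e, f]) 0 r a

lemma det6_sub0 : det6 (a - a') b c d e f = det6 a b c d e f - det6 a' b c d e f := by
  rw [sub_eq_add_neg, ← neg_one_smul ℝ a', det6_add0, det6_smul0]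
  ring

lemma det6_add1 : det6 a (b + b') c d e f = det6 a b c d e f + det6 a b' c d e f := by
  rw [det6_swap01, det6_add0, det6_swap01 b, det6_swap01 b']
  ring

lemma det6_smul1 : det6 a (r • b) c d e f = r * det6 a b c d e f := by
  rw [det6_swap01, det6_smul0, det6_swap01 b]
  ring

lemma det6_add2 : det6 a b (c + c') d e f = det6 a b c d e f + det6 a b c' d e f := by
  rw [det6_swap12, det6_add1, det6_swap12 a c, det6_swap12 a c']
  ring

lemma det6_smul2 : det6 a b (r • c) d e f = r * det6 a b c d e f := by
  rw [det6_swap12, det6_smul1, det6_swap12 a c]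
  ring

lemma det6_self01 : det6 a a c d e f = 0 := by
  linarith [det6_swap01 a a c d e f]

lemma det6_self12 : det6 a b b d e f = 0 := by
  linarith [det6_swap12 a b b d e f]

lemma det6_self23 : det6 a b c c e f = 0 := by
  linarith [det6_swap23 a b c c e f]

lemma det6_self34 : det6 a b c d d f = 0 := by
  linarith [det6_swap34 a b c d d f]

lemma det6_self45 : det6 a b c d e e = 0 := by
  linarith [det6_swap45 a b c d e e]

end det6

/-- The three-term Plücker relation. -/
lemma det6_plucker (u₁ u₂ u₃ u₄ x y s t : Fin 6 → ℝ) :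
    det6 x y u₁ u₂ u₃ u₄ * det6 s t u₁ u₂ u₃ u₄ - det6 x s u₁ u₂ u₃ u₄ * det6 y t u₁ u₂ u₃ u₄ +
      det6 x t u₁ u₂ u₃ u₄ * det6 y s u₁ u₂ u₃ u₄ = 0 := by
  have hdep : ¬ LinearIndependent ℝ ![x, y, s, u₁, u₂, u₃, u₄] := fun h => by
    simpa using h.fintype_card_le_finrank
  obtain ⟨g, hg, i, hi⟩ := Fintype.not_linearIndependent_iff.1 hdep
  simp only [Fin.sum_univ_seven] at hg
  dsimp at hg
  have expand : ∀ v, g 0 * det6 x v u₁ u₂ u₃ u₄ + g 1 * det6 y v u₁ u₂ u₃ u₄ +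
      g 2 * det6 s v u₁ u₂ u₃ u₄ = 0 := by
    intro v
    have h := congrArg (fun w => det6 w v u₁ u₂ u₃ u₄) hg
    have h₁ : det6 u₁ v u₁ u₂ u₃ u₄ = 0 := by
      rw [det6_swap12, det6_self01, neg_zero]
    have h₂ : det6 u₂ v u₁ u₂ u₃ u₄ = 0 := by
      rw [det6_swap23, det6_swap12, det6_self01, neg_zero, neg_zero]
    have h₃ : det6 u₃ v u₁ u₂ u₃ u₄ = 0 := by
      rw [det6_swap34, det6_swap23, det6_swap12, det6_self01]
      simp
    have h₄ : det6 u₄ v u₁ u₂ u₃ u₄ = 0 := by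
      rw [det6_swap45, det6_swap34, det6_swap23, det6_swap12, det6_self01]
      simp
    have h₀ : det6 0 v u₁ u₂ u₃ u₄ = 0 := by
      simpa using det6_smul0 0 v u₁ u₂ u₃ u₄ 0
    simp only [det6_add0, det6_smul0, h₀, h₁, h₂, h₃, h₄] at h
    linarith
  by_cases hxys : g 0 = 0 ∧ g 1 = 0 ∧ g 2 = 0
  · have hu : ∀ v w, det6 v w u₁ u₂ u₃ u₄ = 0 := by
      intro v w
      obtain ⟨hg0, hg1, hg2⟩ := hxys
      by_contra hne
      have hli : LinearIndependent ℝ ![v, w, u₁, u₂, u₃, u₄] :=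
        Matrix.linearIndependent_rows_of_det_ne_zero hne
      have := Fintype.linearIndependent_iff.1 hli ![0, 0, g 3, g 4, g 5, g 6] (by
        rw [Fin.sum_univ_six]
        simpa [hg0, hg1, hg2] using hg)
      refine hi ?_
      have a := this 2
      have b := this 3
      have c := this 4
      have d := this 5
      dsimp at a b c d
      fin_cases i <;> assumption
    simp [hu]
  · have ex := expand x
    have ey := expand y
    have es := expand s
    have et := expand t
    have sxy := det6_swap01 y x u₁ u₂ u₃ u₄
    have sxs := det6_swap01 s x u₁ u₂ u₃ u₄
    have sys := det6_swap01 s y u₁ u₂ u₃ u₄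
    rw [det6_self01] at ex ey es
    rw [sxy, sxs] at ex
    rw [sys] at ey
    by_contra hne
    refine hxys ⟨?_, ?_, ?_⟩
    · refine (mul_eq_zero.1 ?_).resolve_right hne
      linear_combination det6 y s u₁ u₂ u₃ u₄ * et + det6 s t u₁ u₂ u₃ u₄ * ey -
        det6 y t u₁ u₂ u₃ u₄ * es
    · refine (mul_eq_zero.1 ?_).resolve_right hne
      linear_combination -det6 x s u₁ u₂ u₃ u₄ * et - det6 s t u₁ u₂ u₃ u₄ * ex +
        det6 x t u₁ u₂ u₃ u₄ * es
    · refine (mul_eq_zero.1 ?_).resolve_right hne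
      linear_combination det6 x y u₁ u₂ u₃ u₄ * et - det6 x t u₁ u₂ u₃ u₄ * ey +
        det6 y t u₁ u₂ u₃ u₄ * ex

/-- The `6 × 6` minor of `Z` on an ordered tuple of rows. -/
noncomputable def bracket (Z : Matrix (Fin 9) (Fin 6) ℝ) (i j k l m n : Fin 9) : ℝ :=
  det6 (Z i) (Z j) (Z k) (Z l) (Z m) (Z n)

section bracket

variable {Z : Matrix (Fin 9) (Fin 6) ℝ} {i j k l m n : Fin 9}

lemma PosMat.bracket_pos (hZ : PosMat Z) (h₁ : i < j) (h₂ : j < k) (h₃ : k < l) (h₄ : l < m)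
    (h₅ : m < n) : 0 < bracket Z i j k l m n := by
  have hmono : StrictMono ![i, j, k, l, m, n] := by
    rw [Fin.strictMono_iff_lt_succ]
    intro x
    fin_cases x <;> assumption
  have hcard : (univ.image ![i, j, k, l, m, n]).card = 6 := by
    rw [card_image_of_injective _ hmono.injective]
    simp
  have hpos := hZ _ hcard
  rw [rowMinor, dif_pos hcard,
    ← orderEmbOfFin_unique hcard (fun x => mem_image_of_mem _ (mem_univ x)) hmono] at hpos
  refine hpos.trans_eq (congrArg Matrix.det ?_)
  ext x y
  fin_cases x <;> rfl

/-- Rewriting rules sorting the arguments of `bracket`. -/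
lemma bracket_sort (Z : Matrix (Fin 9) (Fin 6) ℝ) :
    (∀ i j k l m n, j < i → bracket Z i j k l m n = -bracket Z j i k l m n) ∧
    (∀ i j k l m n, k < j → bracket Z i j k l m n = -bracket Z i k j l m n) ∧
    (∀ i j k l m n, l < k → bracket Z i j k l m n = -bracket Z i j l k m n) ∧
    (∀ i j k l m n, m < l → bracket Z i j k l m n = -bracket Z i j k m l n) ∧
    (∀ i j k l m n, n < m → bracket Z i j k l m n = -bracket Z i j k l n m) ∧
    (∀ i k l m n, bracket Z i i k l m n = 0) ∧
    (∀ i j l m n, bracket Z i j j l m n = 0) ∧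
    (∀ i j k m n, bracket Z i j k k m n = 0) ∧
    (∀ i j k l n, bracket Z i j k l l n = 0) ∧
    (∀ i j k l m, bracket Z i j k l m m = 0) :=
  ⟨fun _ _ _ _ _ _ _ => det6_swap01 .., fun _ _ _ _ _ _ _ => det6_swap12 ..,
    fun _ _ _ _ _ _ _ => det6_swap23 .., fun _ _ _ _ _ _ _ => det6_swap34 ..,
    fun _ _ _ _ _ _ _ => det6_swap45 .., fun _ _ _ _ _ => det6_self01 ..,
    fun _ _ _ _ _ => det6_self12 .., fun _ _ _ _ _ => det6_self23 ..,
    fun _ _ _ _ _ => det6_self34 .., fun _ _ _ _ _ => det6_self45 ..⟩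

end bracket

lemma bracket_ratio_lt (Z : Matrix (Fin 9) (Fin 6) ℝ) (x y s t i j k l : Fin 9)
    (h : 0 < bracket Z x y i j k l * bracket Z s t i j k l) :
    bracket Z x t i j k l * bracket Z y s i j k l <
      bracket Z x s i j k l * bracket Z y t i j k l := by
  have := det6_plucker (Z i) (Z j) (Z k) (Z l) (Z x) (Z y) (Z s) (Z t)
  simp only [bracket] at h ⊢
  linarith

lemma mul_lt_mul_cross_trans {a b c d e f : ℝ} (hb : 0 < b) (hd : 0 < d) (hf : 0 < f)
    (h₁ : a * d < c * b) (h₂ : c * f < e * d) : a * f < e * b := by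
  rw [← div_lt_div_iff₀ hb hd] at h₁
  rw [← div_lt_div_iff₀ hd hf] at h₂
  exact (div_lt_div_iff₀ hb hf).1 (h₁.trans h₂)

lemma mul_lt_mul_weighted_sum {a b a₀ a₁ a₂ b₀ b₁ b₂ w₀ w₁ w₂ : ℝ} (hw₀ : 0 < w₀) (hw₁ : 0 < w₁)
    (hw₂ : 0 < w₂) (h₀ : a * b₀ < a₀ * b) (h₁ : a * b₁ < a₁ * b) (h₂ : a * b₂ < a₂ * b) :
    a * (w₀ * b₀ + w₁ * b₁ + w₂ * b₂) < (w₀ * a₀ + w₁ * a₁ + w₂ * a₂) * b := by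
  linarith [mul_lt_mul_of_pos_left h₀ hw₀, mul_lt_mul_of_pos_left h₁ hw₁,
    mul_lt_mul_of_pos_left h₂ hw₂]

lemma weighted_sum_mul_lt_mul {a b a₀ a₁ a₂ b₀ b₁ b₂ w₀ w₁ w₂ : ℝ} (hw₀ : 0 < w₀) (hw₁ : 0 < w₁)
    (hw₂ : 0 < w₂) (h₀ : a₀ * b < a * b₀) (h₁ : a₁ * b < a * b₁) (h₂ : a₂ * b < a * b₂) :
    (w₀ * a₀ + w₁ * a₁ + w₂ * a₂) * b < a * (w₀ * b₀ + w₁ * b₁ + w₂ * b₂) := by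
  linarith [mul_lt_mul_of_pos_left h₀ hw₀, mul_lt_mul_of_pos_left h₁ hw₁,
    mul_lt_mul_of_pos_left h₂ hw₂]

/-- Replacing the first two rows `p, q` by `p', q'` increases a bracket relatively more when the
remaining rows are larger. -/
lemma PosMat.bracket_ratio_chain {Z : Matrix (Fin 9) (Fin 6) ℝ} (hZ : PosMat Z) {p q p' q' : Fin 9}
    (h : p = 0 ∧ q = 1 ∧ p' = 0 ∧ q' = 2 ∨ p = 0 ∧ q = 2 ∧ p' = 1 ∧ q' = 2) :
    bracket Z p' q' 3 4 5 6 * bracket Z p q 3 4 5 7 <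
      bracket Z p' q' 3 4 5 7 * bracket Z p q 3 4 5 6 ∧
    bracket Z p' q' 3 4 5 7 * bracket Z p q 3 4 5 8 <
      bracket Z p' q' 3 4 5 8 * bracket Z p q 3 4 5 7 ∧
    bracket Z p' q' 3 4 5 8 * bracket Z p q 3 4 7 8 <
      bracket Z p' q' 3 4 7 8 * bracket Z p q 3 4 5 8 ∧
    bracket Z p' q' 3 4 7 8 * bracket Z p q 3 6 7 8 <
      bracket Z p' q' 3 6 7 8 * bracket Z p q 3 4 7 8 ∧
    bracket Z p' q' 3 6 7 8 * bracket Z p q 4 6 7 8 <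
      bracket Z p' q' 4 6 7 8 * bracket Z p q 3 6 7 8 ∧
    bracket Z p' q' 4 6 7 8 * bracket Z p q 5 6 7 8 <
      bracket Z p' q' 5 6 7 8 * bracket Z p q 4 6 7 8 := by
  obtain ⟨c, lo, hi, hc⟩ : ∃ c lo hi : Fin 9,
      p = 0 ∧ q = 1 ∧ p' = 0 ∧ q' = 2 ∧ c = 0 ∧ lo = 1 ∧ hi = 2 ∨
        p = 0 ∧ q = 2 ∧ p' = 1 ∧ q' = 2 ∧ c = 2 ∧ lo = 0 ∧ hi = 1 := by
    rcases h with h | h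
    · exact ⟨0, 1, 2, by tauto⟩
    · exact ⟨2, 0, 1, by tauto⟩
  have key := fun x y j k l => bracket_ratio_lt Z hi lo x y c j k l
  refine ⟨?_, ?_, ?_, ?_, ?_, ?_⟩ <;> [have := key 7 6 3 4 5; have := key 8 7 3 4 5;
    have := key 7 5 3 4 8; have := key 6 4 3 7 8; have := key 4 3 6 7 8; have := key 5 4 6 7 8] <;>
  rcases hc with ⟨rfl, rfl, rfl, rfl, rfl, rfl, rfl⟩ | ⟨rfl, rfl, rfl, rfl, rfl, rfl, rfl⟩ <;>
  · simp only [bracket_sort, Fin.reduceLT, neg_neg, neg_mul_neg] at this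
    exact this (mul_pos (by apply hZ.bracket_pos <;> decide) (by apply hZ.bracket_pos <;> decide))

lemma PosMat.block_sum_lt {Z : Matrix (Fin 9) (Fin 6) ℝ} (hZ : PosMat Z) {β γ : Fin 3 → ℝ}
    (hβ : ∀ i, 0 < β i) (hγ : ∀ i, 0 < γ i) {p q p' q' : Fin 9}
    (h : p = 0 ∧ q = 1 ∧ p' = 0 ∧ q' = 2 ∨ p = 0 ∧ q = 2 ∧ p' = 1 ∧ q' = 2) :
    (γ 0 * bracket Z p' q' 3 4 5 6 + γ 1 * bracket Z p' q' 3 4 5 7 +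
        γ 2 * bracket Z p' q' 3 4 5 8) *
      (β 0 * bracket Z p q 3 6 7 8 + β 1 * bracket Z p q 4 6 7 8 + β 2 * bracket Z p q 5 6 7 8) <
    (β 0 * bracket Z p' q' 3 6 7 8 + β 1 * bracket Z p' q' 4 6 7 8 +
        β 2 * bracket Z p' q' 5 6 7 8) *
      (γ 0 * bracket Z p q 3 4 5 6 + γ 1 * bracket Z p q 3 4 5 7 +
        γ 2 * bracket Z p q 3 4 5 8) := by
  have pos : ∀ {k l m n : Fin 9}, 3 ≤ k → k < l → l < m → m < n → 0 < bracket Z p q k l m n := by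
    intro k l m n a b c d
    rcases h with ⟨rfl, rfl, -⟩ | ⟨rfl, rfl, -⟩ <;>
      exact hZ.bracket_pos (by decide) (lt_of_lt_of_le (by decide) a) b c d
  obtain ⟨s0, s1, s2, s3, s4, s5⟩ := hZ.bracket_ratio_chain h
  have p3456 : 0 < bracket Z p q 3 4 5 6 := pos (by decide) (by decide) (by decide) (by decide)
  have p3457 : 0 < bracket Z p q 3 4 5 7 := pos (by decide) (by decide) (by decide) (by decide)
  have p3458 : 0 < bracket Z p q 3 4 5 8 := pos (by decide) (by decide) (by decide) (by decide)
  have p3478 : 0 < bracket Z p q 3 4 7 8 := pos (by decide) (by decide) (by decide) (by decide)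
  have p3678 : 0 < bracket Z p q 3 6 7 8 := pos (by decide) (by decide) (by decide) (by decide)
  have p4678 : 0 < bracket Z p q 4 6 7 8 := pos (by decide) (by decide) (by decide) (by decide)
  have p5678 : 0 < bracket Z p q 5 6 7 8 := pos (by decide) (by decide) (by decide) (by decide)
  have t₁ := mul_lt_mul_cross_trans p3457 p3458 p3478 s1 s2
  have t₀ := mul_lt_mul_cross_trans p3456 p3457 p3478 s0 t₁
  have t₄ := mul_lt_mul_cross_trans p3478 p3678 p4678 s3 s4
  have t₅ := mul_lt_mul_cross_trans p3478 p4678 p5678 t₄ s5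
  refine mul_lt_mul_cross_trans (c := bracket Z p' q' 3 4 7 8) (d := bracket Z p q 3 4 7 8) ?_
    p3478 ?_ (weighted_sum_mul_lt_mul (hγ 0) (hγ 1) (hγ 2) t₀ t₁ s2)
    (mul_lt_mul_weighted_sum (hβ 0) (hβ 1) (hβ 2) s3 t₄ t₅)
  · linarith [mul_pos (hγ 0) p3456, mul_pos (hγ 1) p3457, mul_pos (hγ 2) p3458]
  · linarith [mul_pos (hβ 0) p3678, mul_pos (hβ 1) p4678, mul_pos (hβ 2) p5678]

/-- The normal form `C * Z` of a point of the spurion tile: the rows are `A - Γ` and `B + Γ`, where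
`A`, `B`, `Γ` are the combinations of the three blocks of rows of `Z` with weights `α`, `β`, `γ`. -/
noncomputable def tileMatrix (Z : Matrix (Fin 9) (Fin 6) ℝ) (α β γ : Fin 3 → ℝ) :
    Matrix (Fin 2) (Fin 6) ℝ :=
  Matrix.of ![α 0 • Z 0 + α 1 • Z 1 + α 2 • Z 2 - (γ 0 • Z 6 + γ 1 • Z 7 + γ 2 • Z 8),
    β 0 • Z 3 + β 1 • Z 4 + β 2 • Z 5 + (γ 0 • Z 6 + γ 1 • Z 7 + γ 2 • Z 8)]

section tileMatrix

variable {Z : Matrix (Fin 9) (Fin 6) ℝ} {α β γ : Fin 3 → ℝ}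

lemma twY_tileMatrix (k l m n : Fin 9) : twY Z (tileMatrix Z α β γ) k l m n =
    (α 0 * (β 0 * bracket Z 0 3 k l m n + β 1 * bracket Z 0 4 k l m n +
          β 2 * bracket Z 0 5 k l m n) +
        α 1 * (β 0 * bracket Z 1 3 k l m n + β 1 * bracket Z 1 4 k l m n +
          β 2 * bracket Z 1 5 k l m n) +
        α 2 * (β 0 * bracket Z 2 3 k l m n + β 1 * bracket Z 2 4 k l m n +
          β 2 * bracket Z 2 5 k l m n)) +
      (α 0 * (γ 0 * bracket Z 0 6 k l m n + γ 1 * bracket Z 0 7 k l m n +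
          γ 2 * bracket Z 0 8 k l m n) +
        α 1 * (γ 0 * bracket Z 1 6 k l m n + γ 1 * bracket Z 1 7 k l m n +
          γ 2 * bracket Z 1 8 k l m n) +
        α 2 * (γ 0 * bracket Z 2 6 k l m n + γ 1 * bracket Z 2 7 k l m n +
          γ 2 * bracket Z 2 8 k l m n)) +
      (γ 0 * (β 0 * bracket Z 3 6 k l m n + β 1 * bracket Z 4 6 k l m n +
          β 2 * bracket Z 5 6 k l m n) +
        γ 1 * (β 0 * bracket Z 3 7 k l m n + β 1 * bracket Z 4 7 k l m n +
          β 2 * bracket Z 5 7 k l m n) +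
        γ 2 * (β 0 * bracket Z 3 8 k l m n + β 1 * bracket Z 4 8 k l m n +
          β 2 * bracket Z 5 8 k l m n)) := by
  have hswap : ∀ p q, det6 (Z p) (Z q) (Z k) (Z l) (Z m) (Z n) =
      -det6 (Z q) (Z p) (Z k) (Z l) (Z m) (Z n) := fun _ _ => det6_swap01 ..
  have hself : ∀ p, det6 (Z p) (Z p) (Z k) (Z l) (Z m) (Z n) = 0 := fun _ => det6_self01 ..
  change det6 (α 0 • Z 0 + α 1 • Z 1 + α 2 • Z 2 - (γ 0 • Z 6 + γ 1 • Z 7 + γ 2 • Z 8))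
    (β 0 • Z 3 + β 1 • Z 4 + β 2 • Z 5 + (γ 0 • Z 6 + γ 1 • Z 7 + γ 2 • Z 8)) _ _ _ _ = _
  simp only [det6_add0, det6_sub0, det6_smul0, det6_add1, det6_smul1, bracket]
  rw [hself 6, hself 7, hself 8, hswap 6 3, hswap 6 4, hswap 6 5, hswap 7 3, hswap 7 4, hswap 7 5,
    hswap 8 3, hswap 8 4, hswap 8 5, hswap 7 6, hswap 8 6, hswap 8 7]
  ring

lemma twY_tileMatrix_pos (hZ : PosMat Z) (hα : ∀ i, 0 < α i) (hβ : ∀ i, 0 < β i)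
    (hγ : ∀ i, 0 < γ i) : 0 < twY Z (tileMatrix Z α β γ) 0 1 7 8 := by
  have a2 := hα 2
  have b0 := hβ 0
  have b1 := hβ 1
  have b2 := hβ 2
  have c0 := hγ 0
  have p₁ : 0 < bracket Z 0 1 2 3 7 8 := by apply hZ.bracket_pos <;> decide
  have p₂ : 0 < bracket Z 0 1 2 4 7 8 := by apply hZ.bracket_pos <;> decide
  have p₃ : 0 < bracket Z 0 1 2 5 7 8 := by apply hZ.bracket_pos <;> decide
  have p₄ : 0 < bracket Z 0 1 2 6 7 8 := by apply hZ.bracket_pos <;> decide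
  have p₅ : 0 < bracket Z 0 1 3 6 7 8 := by apply hZ.bracket_pos <;> decide
  have p₆ : 0 < bracket Z 0 1 4 6 7 8 := by apply hZ.bracket_pos <;> decide
  have p₇ : 0 < bracket Z 0 1 5 6 7 8 := by apply hZ.bracket_pos <;> decide
  rw [twY_tileMatrix]
  simp only [bracket_sort, Fin.reduceLT, neg_neg, neg_zero, mul_zero, add_zero, zero_add]
  positivity

lemma finrank_rowSpan_tileMatrix (hZ : PosMat Z) (hα : ∀ i, 0 < α i) (hβ : ∀ i, 0 < β i)
    (hγ : ∀ i, 0 < γ i) : Module.finrank ℝ (rowSpan (tileMatrix Z α β γ)) = 2 := by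
  have hli := Matrix.linearIndependent_rows_of_det_ne_zero
    (twY_tileMatrix_pos hZ hα hβ hγ).ne'
  have : LinearIndependent ℝ fun i => tileMatrix Z α β γ i := by
    have h := hli.comp ![0, 1] (by decide)
    have e : (fun i => tileMatrix Z α β γ i) = (Matrix.of ![tileMatrix Z α β γ 0,
        tileMatrix Z α β γ 1, Z 0, Z 1, Z 7, Z 8]).row ∘ ![0, 1] := by
      funext i
      fin_cases i <;> rfl
    rw [e]
    exact h
  exact (finrank_span_eq_card this).trans (by simp)

lemma exists_spurionCell_mul_eq_tileMatrix (Z : Matrix (Fin 9) (Fin 6) ℝ) (hα : ∀ i, 0 < α i)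
    (hβ : ∀ i, 0 < β i) (hγ : ∀ i, 0 < γ i) :
    ∃ C, SpurionCell C ∧ C * Z = tileMatrix Z α β γ := by
  refine ⟨Matrix.of ![![α 0, α 1, α 2, 0, 0, 0, -γ 0, -γ 1, -γ 2],
    ![0, 0, 0, β 0, β 1, β 2, γ 0, γ 1, γ 2]], ?_, ?_⟩
  · have a0 := hα 0
    have a1 := hα 1
    have a2 := hα 2
    have b0 := hβ 0
    have b1 := hβ 1
    have b2 := hβ 2
    have c0 := hγ 0
    have c1 := hγ 1
    have c2 := hγ 2
    intro i j hij
    fin_cases i <;> fin_cases j <;> simp [minor2] at hij ⊢ <;> first | positivity | ring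
  · ext i j
    fin_cases i
    · simp [Matrix.mul_apply, Fin.sum_univ_succ, tileMatrix]
      ring
    · simp [Matrix.mul_apply, Fin.sum_univ_succ, tileMatrix]
      ring

lemma SpurionCell.exists_tileMatrix {C : Matrix (Fin 2) (Fin 9) ℝ} (hC : SpurionCell C)
    (Z : Matrix (Fin 9) (Fin 6) ℝ) :
    ∃ α β γ : Fin 3 → ℝ, (∀ i, 0 < α i) ∧ (∀ i, 0 < β i) ∧ (∀ i, 0 < γ i) ∧
      rowSpan (tileMatrix Z α β γ) ≤ rowSpan (C * Z) := by
  have pos : ∀ i j : Fin 9, i < j → (i : ℕ) / 3 ≠ (j : ℕ) / 3 → 0 < minor2 C i j :=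
    fun i j h h' => (hC i j h).2 h'
  have zero : ∀ i j : Fin 9, i < j → (i : ℕ) / 3 = (j : ℕ) / 3 → minor2 C i j = 0 :=
    fun i j h h' => (hC i j h).1 h'
  refine ⟨![minor2 C 0 6 * minor2 C 0 3, minor2 C 0 6 * minor2 C 1 3, minor2 C 0 6 * minor2 C 2 3],
    ![minor2 C 3 6 * minor2 C 0 3, minor2 C 3 6 * minor2 C 0 4, minor2 C 3 6 * minor2 C 0 5],
    ![minor2 C 0 6 * minor2 C 3 6, minor2 C 0 6 * minor2 C 3 7, minor2 C 0 6 * minor2 C 3 8],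
    ?_, ?_, ?_, ?_⟩
  · intro i
    fin_cases i <;> exact mul_pos (by apply pos <;> decide) (by apply pos <;> decide)
  · intro i
    fin_cases i <;> exact mul_pos (by apply pos <;> decide) (by apply pos <;> decide)
  · intro i
    fin_cases i <;> exact mul_pos (by apply pos <;> decide) (by apply pos <;> decide)
  · have z₁ := zero 0 1 (by decide) (by decide)
    have z₂ := zero 0 2 (by decide) (by decide)
    have z₃ := zero 3 4 (by decide) (by decide)
    have z₄ := zero 3 5 (by decide) (by decide)
    have z₅ := zero 6 7 (by decide) (by decide)
    have z₆ := zero 6 8 (by decide) (by decide)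
    have mem : ∀ i, (C * Z) i ∈ rowSpan (C * Z) := fun i => Submodule.subset_span ⟨i, rfl⟩
    rw [rowSpan, Submodule.span_le]
    rintro _ ⟨i, rfl⟩
    fin_cases i
    · change tileMatrix _ _ _ _ 0 ∈ rowSpan (C * Z)
      convert (rowSpan (C * Z)).sub_mem
        ((rowSpan (C * Z)).smul_mem (minor2 C 0 6 * C 1 3) (mem 0))
        ((rowSpan (C * Z)).smul_mem (minor2 C 0 6 * C 0 3) (mem 1)) using 1
      ext j
      simp [Matrix.mul_apply, Fin.sum_univ_succ, tileMatrix]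
      simp only [minor2] at *
      linear_combination (C 0 0 * C 1 6 - C 0 6 * C 1 0) * (Z 4 j * z₃ + Z 5 j * z₄)
    · change tileMatrix _ _ _ _ 1 ∈ rowSpan (C * Z)
      convert (rowSpan (C * Z)).sub_mem
        ((rowSpan (C * Z)).smul_mem (minor2 C 3 6 * C 0 0) (mem 1))
        ((rowSpan (C * Z)).smul_mem (minor2 C 3 6 * C 1 0) (mem 0)) using 1
      ext j
      simp [Matrix.mul_apply, Fin.sum_univ_succ, tileMatrix]
      simp only [minor2] at *
      linear_combination (C 0 0 * C 1 3 - C 0 3 * C 1 0) * (Z 7 j * z₅ + Z 8 j * z₆) -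
        (C 0 3 * C 1 6 - C 0 6 * C 1 3) * (Z 1 j * z₁ + Z 2 j * z₂)

end tileMatrix

lemma mem_rowSpan_iff {n : ℕ} {Y : Matrix (Fin 2) (Fin n) ℝ} {v : Fin n → ℝ} :
    v ∈ rowSpan Y ↔ ∃ s t : ℝ, s • Y 0 + t • Y 1 = v := by
  rw [rowSpan, Submodule.mem_span_range_iff_exists_fun]
  constructor
  · rintro ⟨c, rfl⟩
    exact ⟨c 0, c 1, (Fin.sum_univ_two fun i => c i • Y i).symm⟩
  · rintro ⟨s, t, rfl⟩
    exact ⟨![s, t], by simp [Fin.sum_univ_two]⟩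

/-- The cross product of three vectors of `ℝ⁴`. -/
def cross4 (a b c : Fin 4 → ℝ) : Fin 4 → ℝ :=
  ![-(a 1 * (b 2 * c 3 - b 3 * c 2) - a 2 * (b 1 * c 3 - b 3 * c 1) +
        a 3 * (b 1 * c 2 - b 2 * c 1)),
    a 0 * (b 2 * c 3 - b 3 * c 2) - a 2 * (b 0 * c 3 - b 3 * c 0) + a 3 * (b 0 * c 2 - b 2 * c 0),
    -(a 0 * (b 1 * c 3 - b 3 * c 1) - a 1 * (b 0 * c 3 - b 3 * c 0) +
        a 3 * (b 0 * c 1 - b 1 * c 0)),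
    a 0 * (b 1 * c 2 - b 2 * c 1) - a 1 * (b 0 * c 2 - b 2 * c 0) + a 2 * (b 0 * c 1 - b 1 * c 0)]

lemma det_eq_cross4_dotProduct (a b c d : Fin 4 → ℝ) :
    (Matrix.of ![a, b, c, d]).det = cross4 a b c ⬝ᵥ d := by
  simp [Matrix.det_succ_row_zero, Fin.sum_univ_succ, cross4, dotProduct, Fin.succAbove]
  ring

lemma cross4_cycle (a b c : Fin 4 → ℝ) : cross4 a b c = cross4 b c a := by
  ext i
  fin_cases i <;> simp [cross4] <;> ring

/-- The intersection of the span of `a, b, c` with the hyperplanes orthogonal to `ψ` and `χ`. -/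
lemma cross4_cross4 (a b c ψ χ : Fin 4 → ℝ) :
    (ψ ⬝ᵥ b * χ ⬝ᵥ c - ψ ⬝ᵥ c * χ ⬝ᵥ b) • a - (ψ ⬝ᵥ a * χ ⬝ᵥ c - ψ ⬝ᵥ c * χ ⬝ᵥ a) • b +
      (ψ ⬝ᵥ a * χ ⬝ᵥ b - ψ ⬝ᵥ b * χ ⬝ᵥ a) • c = -cross4 (cross4 a b c) ψ χ := by
  ext i
  fin_cases i <;> simp [cross4, dotProduct, Fin.sum_univ_succ] <;> ring

lemma det4_cycle (a b c d : Fin 4 → ℝ) :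
    (Matrix.of ![a, b, c, d]).det = -(Matrix.of ![b, c, d, a]).det := by
  simp only [det_eq_cross4_dotProduct]
  simp [cross4, dotProduct, Fin.sum_univ_succ]
  ring

/-- Fixing the first two rows of a determinant and restricting the others to the image of a linear
map `σ` gives a multiple of the determinant. -/
lemma exists_det_vecCons_vecCons {R : Type*} [CommRing R] {n : ℕ} (x y : Fin (n + 2) → R)
    (σ : (Fin n → R) →ₗ[R] Fin (n + 2) → R) : ∃ κ : R, ∀ v : Fin n → Fin n → R,
      (Matrix.of (Matrix.vecCons x (Matrix.vecCons y fun i => σ (v i)))).det =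
        κ * (Matrix.of v).det := by
  have h := (((Matrix.detRowAlternating.curryLeft x).curryLeft y).compLinearMap σ).eq_smul_basis_det
    (Pi.basisFun R (Fin n))
  rw [Pi.basisFun_det] at h
  exact ⟨_, fun v => congrArg (fun f => f v) h⟩

/-- Modulo the row space of `Y`, the determinants `det6 (Y 0) (Y 1) a b c d` are proportional to
determinants in `ℝ⁴`. -/
lemma exists_det6_eq_mul_det {Y : Matrix (Fin 2) (Fin 6) ℝ}
    (hY : Module.finrank ℝ (rowSpan Y) = 2) :
    ∃ (π : (Fin 6 → ℝ) →ₗ[ℝ] Fin 4 → ℝ) (κ : ℝ), LinearMap.ker π = rowSpan Y ∧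
      ∀ a b c d, det6 (Y 0) (Y 1) a b c d = κ * (Matrix.of ![π a, π b, π c, π d]).det := by
  have hfin : Module.finrank ℝ ((Fin 6 → ℝ) ⧸ rowSpan Y) = Module.finrank ℝ (Fin 4 → ℝ) := by
    have := (rowSpan Y).finrank_quotient_add_finrank
    simp only [Module.finrank_fin_fun] at this ⊢
    omega
  let e := LinearEquiv.ofFinrankEq _ _ hfin
  let π := e.toLinearMap ∘ₗ (rowSpan Y).mkQ
  have hker : LinearMap.ker π = rowSpan Y := by
    rw [LinearEquiv.ker_comp, Submodule.ker_mkQ]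
  obtain ⟨σ, hσ⟩ := π.exists_rightInverse_of_surjective
    (LinearMap.range_eq_top.2 (e.surjective.comp (Submodule.mkQ_surjective _)))
  obtain ⟨κ, hκ⟩ := exists_det_vecCons_vecCons (n := 4) (Y 0) (Y 1) σ
  have hdet : ∀ a b c d, det6 (Y 0) (Y 1) (σ a) (σ b) (σ c) (σ d) =
      κ * (Matrix.of ![a, b, c, d]).det := by
    intro a b c d
    rw [← hκ, det6]
    congr 2
    ext i j
    fin_cases i <;> rfl
  have hsub : ∀ a b c d, det6 (Y 0) (Y 1) a b c d = det6 (Y 0) (Y 1) (σ (π a)) b c d := by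
    intro a b c d
    have hmem : a - σ (π a) ∈ rowSpan Y := by
      rw [← hker, LinearMap.mem_ker, map_sub, sub_eq_zero]
      exact (LinearMap.congr_fun hσ (π a)).symm
    obtain ⟨s, t, hst⟩ := mem_rowSpan_iff.1 hmem
    have ha : a = σ (π a) + (s • Y 0 + t • Y 1) := by rw [hst]; abel
    conv_lhs => rw [ha]
    rw [det6_add2, det6_add2, det6_smul2, det6_smul2, det6_self12, det6_swap12 _ _ (Y 0),
      det6_self01]
    simp
  have hcyc : ∀ a b c d, det6 (Y 0) (Y 1) a b c d = -det6 (Y 0) (Y 1) b c d a := by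
    intro a b c d
    rw [det6_swap23, det6_swap34, det6_swap45]
    simp
  refine ⟨π, κ, hker, fun a b c d => ?_⟩
  rw [hsub, hcyc, hsub b, hcyc, hsub c, hcyc, hsub d, hcyc, neg_neg, neg_neg, hdet]

section weights

variable (Z : Matrix (Fin 9) (Fin 6) ℝ) (Y : Matrix (Fin 2) (Fin 6) ℝ)

/-- The coefficients of the first block in the normal form `tileMatrix` of `Y`, up to scaling. -/
noncomputable def weightA : Fin 3 → ℝ :=
  ![-(twY Z Y 6 7 8 1 * twY Z Y 2 3 4 5 - twY Z Y 6 7 8 2 * twY Z Y 1 3 4 5),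
    twY Z Y 6 7 8 0 * twY Z Y 2 3 4 5 - twY Z Y 6 7 8 2 * twY Z Y 0 3 4 5,
    -(twY Z Y 6 7 8 0 * twY Z Y 1 3 4 5 - twY Z Y 6 7 8 1 * twY Z Y 0 3 4 5)]

/-- The coefficients of the second block in the normal form `tileMatrix` of `Y`, up to scaling. -/
noncomputable def weightB : Fin 3 → ℝ :=
  ![-(twY Z Y 0 1 2 5 * twY Z Y 4 6 7 8 - twY Z Y 0 1 2 4 * twY Z Y 5 6 7 8),
    twY Z Y 0 1 2 5 * twY Z Y 3 6 7 8 - twY Z Y 0 1 2 3 * twY Z Y 5 6 7 8,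
    -(twY Z Y 0 1 2 4 * twY Z Y 3 6 7 8 - twY Z Y 0 1 2 3 * twY Z Y 4 6 7 8)]

/-- The coefficients of the third block in the normal form `tileMatrix` of `Y`, up to scaling. -/
noncomputable def weightC : Fin 3 → ℝ :=
  ![-(twY Z Y 3 4 5 7 * twY Z Y 8 0 1 2 - twY Z Y 3 4 5 8 * twY Z Y 7 0 1 2),
    twY Z Y 3 4 5 6 * twY Z Y 8 0 1 2 - twY Z Y 3 4 5 8 * twY Z Y 6 0 1 2,
    -(twY Z Y 3 4 5 6 * twY Z Y 7 0 1 2 - twY Z Y 3 4 5 7 * twY Z Y 6 0 1 2)]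

variable {Z Y}

lemma spurionSigns_iff : SpurionSigns Z Y ↔
    (∀ i, 0 < weightA Z Y i) ∧ (∀ i, 0 < weightB Z Y i) ∧ ∀ i, 0 < weightC Z Y i := by
  simp only [SpurionSigns, Fin.forall_fin_succ, weightA, weightB, weightC, Left.neg_pos_iff,
    Matrix.cons_val_zero, Matrix.cons_val_succ, IsEmpty.forall_iff, and_true]
  exact ⟨fun ⟨h₂, h₅, h₈, h₁, h₃, h₄, h₆, h₇, h₉⟩ => ⟨⟨h₄, h₅, h₆⟩, ⟨h₁, h₂, h₃⟩, h₇, h₈, h₉⟩,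
    fun ⟨⟨h₄, h₅, h₆⟩, ⟨h₁, h₂, h₃⟩, h₇, h₈, h₉⟩ => ⟨h₂, h₅, h₈, h₁, h₃, h₄, h₆, h₇, h₉⟩⟩

/-- The cross products of the three blocks of rows of `Z` modulo the row space of `Y` express the
weights of `Y`. -/
lemma rowSpan_tileMatrix_weight_le (Z : Matrix (Fin 9) (Fin 6) ℝ)
    (hY : Module.finrank ℝ (rowSpan Y) = 2) :
    rowSpan (tileMatrix Z (weightA Z Y) (weightB Z Y) (weightC Z Y)) ≤ rowSpan Y := by
  obtain ⟨π, κ, hker, hπ⟩ := exists_det6_eq_mul_det hY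
  have htw : ∀ i j k l, twY Z Y i j k l =
      κ * (cross4 (π (Z i)) (π (Z j)) (π (Z k)) ⬝ᵥ π (Z l)) := by
    intro i j k l
    rw [← det_eq_cross4_dotProduct, ← hπ]
    rfl
  have htw' : ∀ i j k l, twY Z Y i j k l =
      -(κ * (cross4 (π (Z j)) (π (Z k)) (π (Z l)) ⬝ᵥ π (Z i))) := by
    intro i j k l
    rw [htw, ← det_eq_cross4_dotProduct, ← det_eq_cross4_dotProduct, det4_cycle, mul_neg]
  have hA := cross4_cross4 (π (Z 0)) (π (Z 1)) (π (Z 2))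
    (cross4 (π (Z 3)) (π (Z 4)) (π (Z 5))) (cross4 (π (Z 6)) (π (Z 7)) (π (Z 8)))
  have hB := cross4_cross4 (π (Z 3)) (π (Z 4)) (π (Z 5))
    (cross4 (π (Z 6)) (π (Z 7)) (π (Z 8))) (cross4 (π (Z 0)) (π (Z 1)) (π (Z 2)))
  have hC := cross4_cross4 (π (Z 6)) (π (Z 7)) (π (Z 8))
    (cross4 (π (Z 0)) (π (Z 1)) (π (Z 2))) (cross4 (π (Z 3)) (π (Z 4)) (π (Z 5)))
  rw [cross4_cycle (cross4 (π (Z 6)) _ _)] at hC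
  rw [← cross4_cycle (cross4 (π (Z 0)) _ _)] at hB
  rw [← hker, rowSpan, Submodule.span_le]
  rintro _ ⟨i, rfl⟩
  change tileMatrix _ _ _ _ i ∈ LinearMap.ker π
  rw [LinearMap.mem_ker]
  ext j
  have hAC := congrFun (hA.trans hC.symm) j
  have hBC := congrFun (hB.trans hC.symm) j
  simp only [Pi.add_apply, Pi.sub_apply, Pi.smul_apply, smul_eq_mul] at hAC hBC
  have h₀ := htw 0 1 2
  have h₁ := fun i => htw' i 0 1 2
  have h₂ := htw 3 4 5
  have h₃ := fun i => htw' i 3 4 5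
  have h₄ := htw 6 7 8
  have h₅ := fun i => htw' i 6 7 8
  fin_cases i
  · change π (_ • _ + _ • _ + _ • _ - (_ • _ + _ • _ + _ • _)) j = 0
    simp [weightA, weightC, h₁, h₂, h₃, h₄]
    linear_combination -κ ^ 2 * hAC
  · change π (_ • _ + _ • _ + _ • _ + (_ • _ + _ • _ + _ • _)) j = 0
    simp [weightB, weightC, h₀, h₁, h₂, h₅]
    linear_combination κ ^ 2 * hBC

end weights

lemma eq_zero_of_combination_mem_rowSpan {Z : Matrix (Fin 9) (Fin 6) ℝ}
    {Y : Matrix (Fin 2) (Fin 6) ℝ} {p q r k : Fin 9} (h : twY Z Y p q r k ≠ 0) {c : Fin 3 → ℝ}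
    (hc : c 0 • Z p + c 1 • Z q + c 2 • Z r ∈ rowSpan Y) : c = 0 := by
  obtain ⟨s, t, hst⟩ := mem_rowSpan_iff.1 hc
  have hli : LinearIndependent ℝ ![Y 0, Y 1, Z p, Z q, Z r, Z k] :=
    Matrix.linearIndependent_rows_of_det_ne_zero h
  have hsum : -s • Y 0 + -t • Y 1 + c 0 • Z p + c 1 • Z q + c 2 • Z r = 0 := by
    rw [add_assoc, add_assoc, ← add_assoc (c 0 • Z p), ← hst]
    module
  have hzero := Fintype.linearIndependent_iff.1 hli ![-s, -t, c 0, c 1, c 2, 0] (by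
    simpa [Fin.sum_univ_six] using hsum)
  have h₀ := hzero 2
  have h₁ := hzero 3
  have h₂ := hzero 4
  dsimp at h₀ h₁ h₂
  ext i
  fin_cases i <;> assumption

section tileMatrix

variable {Z : Matrix (Fin 9) (Fin 6) ℝ} {α β γ : Fin 3 → ℝ}

/-- The bracket of rows `m`, `n`, the second block weighted by `β`, and the third block. -/
noncomputable def blockB (Z : Matrix (Fin 9) (Fin 6) ℝ) (β : Fin 3 → ℝ) (m n : Fin 9) : ℝ :=
  β 0 * bracket Z m n 3 6 7 8 + β 1 * bracket Z m n 4 6 7 8 + β 2 * bracket Z m n 5 6 7 8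

/-- The bracket of rows `m`, `n`, the second block, and the third block weighted by `γ`. -/
noncomputable def blockC (Z : Matrix (Fin 9) (Fin 6) ℝ) (γ : Fin 3 → ℝ) (m n : Fin 9) : ℝ :=
  γ 0 * bracket Z m n 3 4 5 6 + γ 1 * bracket Z m n 3 4 5 7 + γ 2 * bracket Z m n 3 4 5 8

lemma twY_tileMatrix_block_three :
    twY Z (tileMatrix Z α β γ) 6 7 8 0 = -(α 1 * blockB Z β 0 1 + α 2 * blockB Z β 0 2) ∧
    twY Z (tileMatrix Z α β γ) 6 7 8 1 = α 0 * blockB Z β 0 1 - α 2 * blockB Z β 1 2 ∧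
    twY Z (tileMatrix Z α β γ) 6 7 8 2 = α 0 * blockB Z β 0 2 + α 1 * blockB Z β 1 2 := by
  refine ⟨?_, ?_, ?_⟩ <;>
  · rw [twY_tileMatrix]
    simp only [bracket_sort, Fin.reduceLT, neg_neg, neg_zero, mul_zero, add_zero, zero_add, blockB]
    try ring

lemma twY_tileMatrix_block_two :
    twY Z (tileMatrix Z α β γ) 0 3 4 5 = -(α 1 * blockC Z γ 0 1 + α 2 * blockC Z γ 0 2) ∧
    twY Z (tileMatrix Z α β γ) 1 3 4 5 = α 0 * blockC Z γ 0 1 - α 2 * blockC Z γ 1 2 ∧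
    twY Z (tileMatrix Z α β γ) 2 3 4 5 = α 0 * blockC Z γ 0 2 + α 1 * blockC Z γ 1 2 := by
  refine ⟨?_, ?_, ?_⟩ <;>
  · rw [twY_tileMatrix]
    simp only [bracket_sort, Fin.reduceLT, neg_neg, neg_zero, mul_zero, add_zero, zero_add, blockC]
    try ring

lemma blockB_pos (hZ : PosMat Z) (hβ : ∀ i, 0 < β i) {m n : Fin 9} (hmn : m < n) (hn : n < 3) :
    0 < blockB Z β m n := by
  have key : ∀ j : Fin 9, n < j → j < 6 → 0 < bracket Z m n j 6 7 8 := fun j h h' =>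
    hZ.bracket_pos hmn h h' (by decide) (by decide)
  exact add_pos (add_pos (mul_pos (hβ 0) (key 3 hn (by decide)))
    (mul_pos (hβ 1) (key 4 (hn.trans (by decide)) (by decide))))
    (mul_pos (hβ 2) (key 5 (hn.trans (by decide)) (by decide)))

lemma blockC_pos (hZ : PosMat Z) (hγ : ∀ i, 0 < γ i) {m n : Fin 9} (hmn : m < n) (hn : n < 3) :
    0 < blockC Z γ m n := by
  have key : ∀ j : Fin 9, 5 < j → 0 < bracket Z m n 3 4 5 j := fun j h =>
    hZ.bracket_pos hmn hn (by decide) (by decide) h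
  exact add_pos (add_pos (mul_pos (hγ 0) (key 6 (by decide)))
    (mul_pos (hγ 1) (key 7 (by decide)))) (mul_pos (hγ 2) (key 8 (by decide)))

lemma exists_pos_weightA_tileMatrix (hZ : PosMat Z) (hα : ∀ i, 0 < α i) (hβ : ∀ i, 0 < β i)
    (hγ : ∀ i, 0 < γ i) : ∃ L : ℝ, 0 < L ∧ ∀ i, weightA Z (tileMatrix Z α β γ) i = L * α i := by
  have hc := blockC_pos hZ hγ (m := 0) (n := 1) (by decide) (by decide)
  have hc' := blockC_pos hZ hγ (m := 0) (n := 2) (by decide) (by decide)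
  have hc'' := blockC_pos hZ hγ (m := 1) (n := 2) (by decide) (by decide)
  have h₁ : blockC Z γ 0 2 * blockB Z β 0 1 < blockB Z β 0 2 * blockC Z γ 0 1 :=
    hZ.block_sum_lt hβ hγ (.inl ⟨rfl, rfl, rfl, rfl⟩)
  have h₂ : blockC Z γ 1 2 * blockB Z β 0 2 < blockB Z β 1 2 * blockC Z γ 0 2 :=
    hZ.block_sum_lt hβ hγ (.inr ⟨rfl, rfl, rfl, rfl⟩)
  have h₃ : blockB Z β 0 1 * blockC Z γ 1 2 < blockB Z β 1 2 * blockC Z γ 0 1 :=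
    mul_lt_mul_cross_trans (c := blockB Z β 0 2) hc hc' hc'' (by linarith) (by linarith)
  refine ⟨α 0 * (blockB Z β 0 2 * blockC Z γ 0 1 - blockB Z β 0 1 * blockC Z γ 0 2) +
    α 1 * (blockB Z β 1 2 * blockC Z γ 0 1 - blockB Z β 0 1 * blockC Z γ 1 2) +
    α 2 * (blockB Z β 1 2 * blockC Z γ 0 2 - blockB Z β 0 2 * blockC Z γ 1 2),
    add_pos (add_pos (mul_pos (hα 0) (by linarith)) (mul_pos (hα 1) (by linarith)))
      (mul_pos (hα 2) (by linarith)), ?_⟩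
  obtain ⟨b₀, b₁, b₂⟩ := twY_tileMatrix_block_three (Z := Z) (α := α) (β := β) (γ := γ)
  obtain ⟨c₀, c₁, c₂⟩ := twY_tileMatrix_block_two (Z := Z) (α := α) (β := β) (γ := γ)
  intro i
  fin_cases i <;> simp [weightA, b₀, b₁, b₂, c₀, c₁, c₂] <;> ring

lemma spurionSigns_tileMatrix (hZ : PosMat Z) (hα : ∀ i, 0 < α i) (hβ : ∀ i, 0 < β i)
    (hγ : ∀ i, 0 < γ i) : SpurionSigns Z (tileMatrix Z α β γ) := by
  obtain ⟨L, hL, hA⟩ := exists_pos_weightA_tileMatrix hZ hα hβ hγ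
  set Y := tileMatrix Z α β γ with hY
  have hle := rowSpan_tileMatrix_weight_le Z (finrank_rowSpan_tileMatrix hZ hα hβ hγ)
  rw [← hY] at hle
  have mem : ∀ i, tileMatrix Z (weightA Z Y) (weightB Z Y) (weightC Z Y) i - L • Y i ∈ rowSpan Y :=
    fun i => sub_mem (hle (Submodule.subset_span ⟨i, rfl⟩))
      (Submodule.smul_mem _ _ (Submodule.subset_span ⟨i, rfl⟩))
  have hb : twY Z Y 6 7 8 0 < 0 := by
    rw [twY_tileMatrix_block_three.1, neg_lt_zero]
    exact add_pos (mul_pos (hα 1) (blockB_pos hZ hβ (by decide) (by decide)))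
      (mul_pos (hα 2) (blockB_pos hZ hβ (by decide) (by decide)))
  have hc : twY Z Y 3 4 5 0 ≠ 0 := by
    have h : twY Z Y 0 3 4 5 < 0 := by
      rw [twY_tileMatrix_block_two.1, neg_lt_zero]
      exact add_pos (mul_pos (hα 1) (blockC_pos hZ hγ (by decide) (by decide)))
        (mul_pos (hα 2) (blockC_pos hZ hγ (by decide) (by decide)))
    have e : twY Z Y 3 4 5 0 = -twY Z Y 0 3 4 5 := by
      change det6 _ _ _ _ _ _ = -det6 _ _ _ _ _ _
      rw [det6_swap45, det6_swap34, det6_swap23]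
      ring
    rw [e]
    exact neg_ne_zero.2 h.ne
  have row₀ : ∀ a b c, tileMatrix Z a b c 0 =
      a 0 • Z 0 + a 1 • Z 1 + a 2 • Z 2 - (c 0 • Z 6 + c 1 • Z 7 + c 2 • Z 8) := fun _ _ _ => rfl
  have row₁ : ∀ a b c, tileMatrix Z a b c 1 =
      b 0 • Z 3 + b 1 • Z 4 + b 2 • Z 5 + (c 0 • Z 6 + c 1 • Z 7 + c 2 • Z 8) := fun _ _ _ => rfl
  have row₀' := row₀ α β γ
  have row₁' := row₁ α β γ
  rw [← hY] at row₀' row₁'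
  have hC : (fun i => L * γ i - weightC Z Y i) = 0 := by
    refine eq_zero_of_combination_mem_rowSpan hb.ne ?_
    convert mem 0 using 1
    rw [row₀, row₀', hA, hA, hA]
    module
  have hB : (fun i => weightB Z Y i - L * β i) = 0 := by
    refine eq_zero_of_combination_mem_rowSpan hc ?_
    convert add_mem (mem 0) (mem 1) using 1
    rw [row₀, row₁, row₀', row₁', hA, hA, hA]
    module
  refine spurionSigns_iff.2 ⟨fun i => ?_, fun i => ?_, fun i => ?_⟩
  · rw [hA]
    exact mul_pos hL (hα i)
  · rw [sub_eq_zero.1 (congrFun hB i)]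
    exact mul_pos hL (hβ i)
  · rw [← sub_eq_zero.1 (congrFun hC i)]
    exact mul_pos hL (hγ i)

end tileMatrix

/-- The twistor coordinates of two matrices with comparable row spans are proportional. -/
lemma exists_twY_eq_mul {Y Y' : Matrix (Fin 2) (Fin 6) ℝ} (Z : Matrix (Fin 9) (Fin 6) ℝ)
    (h : rowSpan Y' ≤ rowSpan Y) : ∃ g : ℝ, ∀ i j k l, twY Z Y' i j k l = g * twY Z Y i j k l := by
  obtain ⟨p, q, h₀⟩ := mem_rowSpan_iff.1 (h (Submodule.subset_span ⟨0, rfl⟩))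
  obtain ⟨r, s, h₁⟩ := mem_rowSpan_iff.1 (h (Submodule.subset_span ⟨1, rfl⟩))
  dsimp only at h₀ h₁
  refine ⟨p * s - q * r, fun i j k l => ?_⟩
  change det6 (Y' 0) (Y' 1) _ _ _ _ = _ * det6 (Y 0) (Y 1) _ _ _ _
  rw [← h₀, ← h₁]
  simp only [det6_add0, det6_smul0, det6_add1, det6_smul1, det6_self01]
  rw [det6_swap01 (Y 1)]
  ring

lemma SpurionSigns.of_twY_eq_mul {Z : Matrix (Fin 9) (Fin 6) ℝ} {Y Y' : Matrix (Fin 2) (Fin 6) ℝ}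
    {g : ℝ} (hg : ∀ i j k l, twY Z Y' i j k l = g * twY Z Y i j k l) (h : SpurionSigns Z Y') :
    SpurionSigns Z Y := by
  have hw : (∀ i, weightA Z Y' i = g ^ 2 * weightA Z Y i) ∧
      (∀ i, weightB Z Y' i = g ^ 2 * weightB Z Y i) ∧
      ∀ i, weightC Z Y' i = g ^ 2 * weightC Z Y i := by
    refine ⟨fun i => ?_, fun i => ?_, fun i => ?_⟩ <;> fin_cases i <;>
      simp [weightA, weightB, weightC, hg] <;> ring
  rw [spurionSigns_iff] at h ⊢
  simp only [hw.1, hw.2.1, hw.2.2] at h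
  exact ⟨fun i => pos_of_mul_pos_right (h.1 i) (sq_nonneg g),
    fun i => pos_of_mul_pos_right (h.2.1 i) (sq_nonneg g),
    fun i => pos_of_mul_pos_right (h.2.2 i) (sq_nonneg g)⟩

lemma spurionSigns_iff_exists_spurionCell {Z : Matrix (Fin 9) (Fin 6) ℝ} (hZ : PosMat Z)
    {Y : Matrix (Fin 2) (Fin 6) ℝ} (hY : Module.finrank ℝ (rowSpan Y) = 2) :
    SpurionSigns Z Y ↔ ∃ C, SpurionCell C ∧ rowSpan (C * Z) = rowSpan Y := by
  constructor
  · intro h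
    obtain ⟨hα, hβ, hγ⟩ := spurionSigns_iff.1 h
    obtain ⟨C, hC, hCZ⟩ := exists_spurionCell_mul_eq_tileMatrix Z hα hβ hγ
    refine ⟨C, hC, ?_⟩
    rw [hCZ]
    exact Submodule.eq_of_le_of_finrank_eq (rowSpan_tileMatrix_weight_le Z hY)
      ((finrank_rowSpan_tileMatrix hZ hα hβ hγ).trans hY.symm)
  · rintro ⟨C, hC, hCY⟩
    obtain ⟨α, β, γ, hα, hβ, hγ, hle⟩ := hC.exists_tileMatrix Z
    obtain ⟨g, hg⟩ := exists_twY_eq_mul Z (hle.trans hCY.le)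
    exact (spurionSigns_tileMatrix hZ hα hβ hγ).of_twY_eq_mul hg

lemma exists_rowSpan_eq {V : Submodule ℝ (Fin 6 → ℝ)} (hV : Module.finrank ℝ V = 2) :
    ∃ Y : Matrix (Fin 2) (Fin 6) ℝ, rowSpan Y = V := by
  let b := Module.finBasisOfFinrankEq ℝ V hV
  refine ⟨Matrix.of fun i => (b i : Fin 6 → ℝ), ?_⟩
  have h := congrArg (Submodule.map V.subtype) b.span_eq
  rwa [Submodule.map_span, ← Set.range_comp, Submodule.map_subtype_top] at h

/-- Semialgebraic description of the open spurion tile: a `2`-dimensional subspace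
`V ⊆ ℝ⁶` is the row span of `C * Z` for some `C` in the spurion cell if and only if,
for every (equivalently, some) rank-`2` matrix `Y` with row span `V`, the spurion
sign conditions hold for `Y`. -/
theorem spurion_tile_semialgebraic_description (Z : Matrix (Fin 9) (Fin 6) ℝ)
    (hZ : PosMat Z) (V : Submodule ℝ (Fin 6 → ℝ)) (hV : Module.finrank ℝ V = 2) :
    ((∃ C, SpurionCell C ∧ rowSpan (C * Z) = V) ↔
      ∀ Y : Matrix (Fin 2) (Fin 6) ℝ, Y.rank = 2 → rowSpan Y = V → SpurionSigns Z Y) ∧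
    ((∃ C, SpurionCell C ∧ rowSpan (C * Z) = V) ↔
      ∃ Y : Matrix (Fin 2) (Fin 6) ℝ, Y.rank = 2 ∧ rowSpan Y = V ∧ SpurionSigns Z Y) := by
  have key : ∀ Y : Matrix (Fin 2) (Fin 6) ℝ, rowSpan Y = V →
      (SpurionSigns Z Y ↔ ∃ C, SpurionCell C ∧ rowSpan (C * Z) = V) := by
    rintro Y rfl
    exact spurionSigns_iff_exists_spurionCell hZ hV
  obtain ⟨Y₀, hY₀⟩ := exists_rowSpan_eq hV
  have hrank : Y₀.rank = 2 := by
    rw [← hY₀] at hV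
    rw [Matrix.rank_eq_finrank_span_row]
    exact hV
  exact ⟨⟨fun h Y _ hY => (key Y hY).2 h, fun h => (key Y₀ hY₀).1 (h Y₀ hrank hY₀)⟩,
    fun h => ⟨Y₀, hrank, hY₀, (key Y₀ hY₀).2 h⟩, fun ⟨Y, _, hY, h⟩ => (key Y hY).1 h⟩
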